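/- Let k ≥ 3, let U be a set of k elements and let C be a set of k+2 elements disjoint from U, and suppose each u ∈ U is equipped with a strict linear order (a ranking without ties) on C. Then it is not possible that for every subset C' ⊆ C with |C'| = k, each c ∈ C' is the top-ranked element of C' according to the ranking of exactly one u ∈ U. -/

import Mathlib

open Finset
open scoped Classical

/-- A `k`-clustering of a finite point set: `k` clusters with designated
distinct centers, each center belonging to its cluster, and the clusters
forming a partition of the point set. -/
structure Clustering (S : Type*) [Fintype S] (k : ℕ) where
  C : Fin k → Finset S
  ctr : Fin k → S
  mem_ctr : ∀ i, ctr i ∈ C i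
  ctr_inj : Function.Injective ctr
  covers : ∀ p : S, ∃ i, p ∈ C i
  disj : ∀ i j, i ≠ j → ∀ p, p ∈ C i → p ∉ C j

section Defs

variable {S : Type*} [Fintype S]

/-- `d` is a (possibly asymmetric) distance function: nonnegative, zero on the
diagonal, and satisfying the triangle inequality. -/
def IsQuasiMetric (d : S → S → ℝ) : Prop :=
  (∀ p q, 0 ≤ d p q) ∧ (∀ p, d p p = 0) ∧ (∀ p q r, d p r ≤ d p q + d q r)

/-- `d` is symmetric. -/
def SymmDist (d : S → S → ℝ) : Prop := ∀ p q, d p q = d q p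

/-- `d'` is an `α`-perturbation of `d`. -/
def IsPerturbation (α : ℝ) (d d' : S → S → ℝ) : Prop :=
  ∀ p q, d p q ≤ d' p q ∧ d' p q ≤ α * d p q

/-- The center set `Cs` covers every point within distance `r`
(i.e. the `k`-center cost of `Cs` is at most `r`). -/
def Covers (d : S → S → ℝ) (Cs : Finset S) (r : ℝ) : Prop :=
  ∀ p : S, ∃ c ∈ Cs, d c p ≤ r

/-- `r` is the optimal `k`-center cost for `(S, d)`. -/
def IsOptCost (d : S → S → ℝ) (k : ℕ) (r : ℝ) : Prop :=
  (∃ Cs : Finset S, Cs.card = k ∧ Covers d Cs r) ∧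
    ∀ (Cs : Finset S) (r' : ℝ), Cs.card = k → Covers d Cs r' → r ≤ r'

/-- Each point is assigned to a closest center (Voronoi partition). -/
def IsVoronoi (d : S → S → ℝ) {k : ℕ} (𝒞 : Clustering S k) : Prop :=
  ∀ i j, ∀ p ∈ 𝒞.C i, d (𝒞.ctr i) p ≤ d (𝒞.ctr j) p

/-- Every point is within distance `r` of the center of its cluster. -/
def HasRadius (d : S → S → ℝ) {k : ℕ} (𝒞 : Clustering S k) (r : ℝ) : Prop :=
  ∀ i, ∀ p ∈ 𝒞.C i, d (𝒞.ctr i) p ≤ r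

/-- `𝒞` is an optimal `k`-center clustering with optimal cost `r`: a Voronoi
partition induced by a set of `k` centers achieving the optimal cost. -/
def IsOptClustering (d : S → S → ℝ) (k : ℕ) (𝒞 : Clustering S k) (r : ℝ) : Prop :=
  IsVoronoi d 𝒞 ∧ HasRadius d 𝒞 r ∧ IsOptCost d k r

/-- Two clusterings are equal as partitions. -/
def SamePartition {k : ℕ} (𝒞 𝒞' : Clustering S k) : Prop :=
  ∃ σ : Equiv.Perm (Fin k), ∀ i, 𝒞.C i = 𝒞'.C (σ i)

/-- `α`-perturbation resilience: under any `α`-perturbation, any optimal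
clustering coincides with `𝒪` as a partition (so it is unique and equals `𝒪`). -/
def PerturbationResilient (d : S → S → ℝ) (k : ℕ) (α : ℝ) (𝒪 : Clustering S k) : Prop :=
  ∀ d' : S → S → ℝ, IsPerturbation α d d' →
    ∀ (𝒞 : Clustering S k) (r : ℝ), IsOptClustering d' k 𝒞 r → SamePartition 𝒞 𝒪

/-- `𝒞` and `𝒞'` agree on all but (at most) an `ε` fraction of the points. -/
def EpsClose {k : ℕ} (ε : ℝ) (𝒞 𝒞' : Clustering S k) : Prop :=
  ∃ σ : Equiv.Perm (Fin k),
    (∑ i, (((𝒞.C i) \ (𝒞'.C (σ i))).card : ℝ)) ≤ ε * Fintype.card S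

/-- `(α, ε)`-perturbation resilience: under any `α`-perturbation, any optimal
clustering is `ε`-close to `𝒪`. -/
def EpsPerturbationResilient (d : S → S → ℝ) (k : ℕ) (α ε : ℝ) (𝒪 : Clustering S k) : Prop :=
  ∀ d' : S → S → ℝ, IsPerturbation α d d' →
    ∀ (𝒞 : Clustering S k) (r : ℝ), IsOptClustering d' k 𝒞 r → EpsClose ε 𝒞 𝒪

/-- `(α, ε)`-approximation stability (`rstar` being the optimal radius): any
`k`-partition with designated centers of cost at most `α · rstar` is `ε`-close to `𝒪`. -/
def ApproxStable (d : S → S → ℝ) (k : ℕ) (α ε rstar : ℝ) (𝒪 : Clustering S k) : Prop :=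
  ∀ 𝒞 : Clustering S k, HasRadius d 𝒞 (α * rstar) → EpsClose ε 𝒞 𝒪

/-- The "symmetrized set" `A` of points behaving symmetrically up to distance `rstar`. -/
def SymSet (d : S → S → ℝ) (rstar : ℝ) : Set S :=
  {p | ∀ q, d q p ≤ rstar → d p q ≤ rstar}

end Defs

/-- Given `k ≥ 3`, a set `U` of `k` elements, a disjoint set `C` of
`k + 2` elements, and a strict ranking of `C` for each `u ∈ U`, it cannot be the
case that for every `k`-subset `C'` of `C`, each element of `C'` is top-ranked in
`C'` by exactly one `u ∈ U`. -/
theorem no_consistent_rankings (k : ℕ) (hk : 3 ≤ k)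
    (U C : Type*) [Fintype U] [Fintype C] [DecidableEq C]
    (hU : Fintype.card U = k) (hC : Fintype.card C = k + 2)
    (rk : U → C → ℕ) (hrk : ∀ u, Function.Injective (rk u)) :
    ¬ ∀ C' : Finset C, C'.card = k → ∀ c ∈ C',
        ∃! u : U, ∀ c' ∈ C', rk u c' ≤ rk u c := by
  intro H
  have : Nonempty C := Fintype.card_pos_iff.mp (by omega)
  have hpair : ∀ {p q : C}, p ≠ q → (({p, q} : Finset C)ᶜ).card = k := by
    intro p q hpq
    rw [card_compl, hC, card_pair hpq]
    omega
  have hmax : ∀ u, ∃ a, ∀ c, rk u c ≤ rk u a := fun u => Finite.exists_max (rk u)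
  choose t ht using hmax
  have htinj : Function.Injective t := by
    intro u u' huu'
    obtain ⟨D, hD, -, hDk⟩ := exists_subsuperset_card_eq (n := k)
      (subset_univ ({t u} : Finset C)) (by rw [card_singleton]; omega)
      (by rw [card_univ]; omega)
    exact (H D hDk (t u) (singleton_subset_iff.mp hD)).unique (fun c _ => ht u c)
      (fun c _ => huu' ▸ ht u' c)
  have hcard : ((univ.image t)ᶜ).card = 2 := by
    rw [card_compl, card_image_of_injective _ htinj, card_univ, hU, hC]
    omega
  obtain ⟨x, y, hxy, hxyt⟩ := card_eq_two.mp hcard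
  have hx : ∀ u, t u ≠ x := by
    have : x ∈ (univ.image t)ᶜ := by simp [hxyt]
    simpa using this
  have hy : ∀ u, t u ≠ y := by
    have : y ∈ (univ.image t)ᶜ := by simp [hxyt]
    simpa using this
  have hnext : ∀ p q : C, p ≠ q → (∀ u, t u ≠ p) → (∀ u, t u ≠ q) →
      ∀ u c, c ≠ p → c ≠ t u → rk u c ≤ rk u q := by
    intro p q hpq hp hq u c hcp hcu
    obtain ⟨v, hv, -⟩ := H _ (hpair (hp u).symm) q (by simp [hpq.symm, (hq u).symm])
    have hvu : v = u := by
      by_contra hne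
      exact hq v (hrk v (le_antisymm
        (hv (t v) (by simp [hp v, htinj.ne hne])) (ht v q)))
    subst hvu
    exact hv c (by simp [hcp, hcu])
  obtain ⟨u, u', hne, heq⟩ := Fintype.exists_ne_map_eq_of_card_lt
    (fun u => decide (rk u x < rk u y)) (by rw [Fintype.card_bool, hU]; omega)
  have hiff : rk u x < rk u y ↔ rk u' x < rk u' y := by simpa using heq
  have hsame : ∀ p q : C, p ≠ q → (∀ u, t u ≠ p) → (∀ u, t u ≠ q) →
      rk u p ≤ rk u q → rk u' p ≤ rk u' q → False := by
    intro p q hpq hp hq hu hu'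
    refine hne ((H _ (hpair (htinj.ne hne)) q
      (by simp [(hq u).symm, (hq u').symm])).unique ?_ ?_)
    · intro c hc
      simp only [mem_compl, mem_insert, mem_singleton, not_or] at hc
      by_cases hcp : c = p
      · exact hcp ▸ hu
      · exact hnext p q hpq hp hq u c hcp hc.1
    · intro c hc
      simp only [mem_compl, mem_insert, mem_singleton, not_or] at hc
      by_cases hcp : c = p
      · exact hcp ▸ hu'
      · exact hnext p q hpq hp hq u' c hcp hc.2
  by_cases h : rk u x < rk u y
  · exact hsame x y hxy hx hy h.le (hiff.mp h).le
  · exact hsame y x hxy.symm hy hx (not_lt.mp h) (not_lt.mp (mt hiff.mpr h))
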